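/- arXiv:2509.12874 — 8 statements merged into one kernel-verified Lean document; each statement's English description precedes it below -/
import Mathlib

section
/- Let θ ≠ 0, r > 0, ρ > 0, δ > 0 and γ > 0 be real numbers with K + δ/γ > 0, where K := r + (ρ−r)/γ + ((γ−1)/(2γ²))θ² is the Merton constant. If m₋ is the smaller root of the quadratic Q(m) := (1/2)θ²m² + (ρ+δ−r−(1/2)θ²)m − (ρ+δ), then m₋ < min{0, 1 − 1/γ}. -/
/-- With θ ≠ 0, r > 0, ρ > 0, δ > 0, γ > 0 and K + δ/γ > 0 where
K := r + (ρ−r)/γ + ((γ−1)/(2γ²))θ² is the Merton constant, the smaller root m₋ of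
Q(m) := (1/2)θ²m² + (ρ+δ−r−(1/2)θ²)m − (ρ+δ) satisfies m₋ < min{0, 1 − 1/γ}. -/
theorem smaller_root_bound (r ρ δ θ γ : ℝ) (hθ : θ ≠ 0) (hr : 0 < r) (hρ : 0 < ρ)
    (hδ : 0 < δ) (hγ : 0 < γ)
    (hK : r + (ρ - r)/γ + ((γ - 1)/(2*γ^2)) * θ^2 + δ/γ > 0)
    (mm mp : ℝ)
    (hmm : (1/2) * θ^2 * mm^2 + (ρ + δ - r - (1/2) * θ^2) * mm - (ρ + δ) = 0)
    (hmp : (1/2) * θ^2 * mp^2 + (ρ + δ - r - (1/2) * θ^2) * mp - (ρ + δ) = 0)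
    (hlt : mm < mp) :
    mm < min 0 (1 - 1/γ) := by
  have ht : 0 < θ^2 := by positivity
  have hsum : (1/2) * θ^2 * (mm + mp) + (ρ + δ - r - (1/2) * θ^2) = 0 := by
    have h : (mp - mm) * ((1/2) * θ^2 * (mm + mp) + (ρ + δ - r - (1/2) * θ^2)) = 0 := by
      linear_combination hmp - hmm
    rcases mul_eq_zero.mp h with h | h
    · linarith
    · exact h
  have key : ∀ x : ℝ,
      (1/2) * θ^2 * x^2 + (ρ + δ - r - (1/2) * θ^2) * x - (ρ + δ) < 0 → mm < x := by
    intro x hx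
    by_contra hle
    push Not at hle
    have h1 : 0 ≤ θ^2 * ((mm - x) * (mp - x)) :=
      mul_nonneg ht.le (mul_nonneg (by linarith) (by linarith))
    have h2 : (1/2) * θ^2 * x^2 + (ρ + δ - r - (1/2) * θ^2) * x - (ρ + δ)
        = (1/2) * (θ^2 * ((mm - x) * (mp - x))) := by
      linear_combination hmm + (x - mm) * hsum
    linarith
  refine lt_min (key 0 (by linarith)) (key _ ?_)
  have h3 : (1/2) * θ^2 * (1 - 1/γ)^2 + (ρ + δ - r - (1/2) * θ^2) * (1 - 1/γ) - (ρ + δ)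
      = -(r + (ρ - r)/γ + ((γ - 1)/(2*γ^2)) * θ^2 + δ/γ) := by
    field_simp
    ring
  linarith
end

section
/- Let γ > 0 with γ ≠ 1, L > 0 and z > 0. Consider the function c ↦ (c+L)^{1−γ}/(1−γ) − c·z on the set {c : c ≥ 0}. If 0 < z < L^{−γ}, then its supremum over c ≥ 0 equals (γ/(1−γ))·z^{(γ−1)/γ} + L·z, and this supremum is attained at c = z^{−1/γ} − L. If z ≥ L^{−γ}, then its supremum over c ≥ 0 equals L^{1−γ}/(1−γ), and this supremum is attained at c = 0. -/
/-- Bernoulli form of the tangent inequality at 1. -/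
theorem crra_tangent_one (γ t : ℝ) (hγ : 0 < γ) (hγ1 : γ ≠ 1) (ht : 0 < t) :
    t ^ (1 - γ) / (1 - γ) ≤ 1 / (1 - γ) + (t - 1) := by
  rcases lt_or_gt_of_ne hγ1 with h | h
  · have h1 : 0 < 1 - γ := by linarith
    have := rpow_one_add_le_one_add_mul_self (s := t - 1) (by linarith) h1.le
      (by linarith : 1 - γ ≤ 1)
    rw [show 1 + (t - 1) = t by ring] at this
    rw [div_le_iff₀ h1, add_mul, one_div, inv_mul_cancel₀ h1.ne']
    linarith
  · have h1 : 1 - γ < 0 := by linarith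
    have hs : 0 < t⁻¹ := inv_pos.mpr ht
    have hB := one_add_mul_self_le_rpow_one_add (s := t⁻¹ - 1) (by linarith) h.le
    rw [show 1 + (t⁻¹ - 1) = t⁻¹ by ring, Real.inv_rpow ht.le, ← Real.rpow_neg ht.le] at hB
    have e : t ^ (1 - γ) = t * t ^ (-γ) := by
      rw [sub_eq_add_neg, Real.rpow_add ht, Real.rpow_one]
    have h2 := mul_le_mul_of_nonneg_left hB ht.le
    have h3 : t * (1 + γ * (t⁻¹ - 1)) = t + γ * (1 - t) := by
      field_simp
    rw [div_le_iff_of_neg h1, add_mul, one_div, inv_mul_cancel₀ h1.ne, e]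
    linarith

/-- Tangent line inequality for CRRA utility. -/
theorem crra_tangent (γ a x : ℝ) (hγ : 0 < γ) (hγ1 : γ ≠ 1) (ha : 0 < a) (hx : 0 < x) :
    x ^ (1 - γ) / (1 - γ) ≤ a ^ (1 - γ) / (1 - γ) + a ^ (-γ) * (x - a) := by
  have h := crra_tangent_one γ (x / a) hγ hγ1 (div_pos hx ha)
  have hp : 0 < a ^ (1 - γ) := Real.rpow_pos_of_pos ha _
  have h2 := mul_le_mul_of_nonneg_left h hp.le
  have e : a ^ (1 - γ) = a * a ^ (-γ) := by
    rw [sub_eq_add_neg, Real.rpow_add ha, Real.rpow_one]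
  have e1 : a ^ (1 - γ) * ((x / a) ^ (1 - γ) / (1 - γ)) = x ^ (1 - γ) / (1 - γ) := by
    rw [Real.div_rpow hx.le ha.le]
    field_simp
  have e2 : a ^ (1 - γ) * (x / a - 1) = a ^ (-γ) * (x - a) := by
    rw [e]
    field_simp
  rw [e1, mul_add, e2] at h2
  calc _ ≤ _ := h2
    _ = _ := by ring

/-- Concave conjugate of the shifted CRRA utility. For γ > 0 with γ ≠ 1,
L > 0 and z > 0, the map c ↦ (c+L)^{1−γ}/(1−γ) − c·z over {c ≥ 0} has supremum
(γ/(1−γ))·z^{(γ−1)/γ} + L·z attained at c = z^{−1/γ} − L when 0 < z < L^{−γ},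
and supremum L^{1−γ}/(1−γ) attained at c = 0 when z ≥ L^{−γ}. -/
theorem shifted_crra_conjugate (γ L z : ℝ) (hγ : 0 < γ) (hγ1 : γ ≠ 1) (hL : 0 < L)
    (hz : 0 < z) :
    (z < L ^ (-γ) →
      IsGreatest ((fun c : ℝ => (c + L) ^ (1 - γ) / (1 - γ) - c * z) '' Set.Ici 0)
        (γ / (1 - γ) * z ^ ((γ - 1)/γ) + L * z) ∧
      z ^ (-1/γ) - L ∈ Set.Ici (0 : ℝ) ∧
      (z ^ (-1/γ) - L + L) ^ (1 - γ) / (1 - γ) - (z ^ (-1/γ) - L) * z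
        = γ / (1 - γ) * z ^ ((γ - 1)/γ) + L * z) ∧
    (L ^ (-γ) ≤ z →
      IsGreatest ((fun c : ℝ => (c + L) ^ (1 - γ) / (1 - γ) - c * z) '' Set.Ici 0)
        (L ^ (1 - γ) / (1 - γ)) ∧
      ((0 : ℝ) + L) ^ (1 - γ) / (1 - γ) - 0 * z = L ^ (1 - γ) / (1 - γ)) := by
  have hg : 1 - γ ≠ 0 := sub_ne_zero.mpr hγ1.symm
  constructor
  · intro hzL
    have ha : 0 < z ^ (-1/γ) := Real.rpow_pos_of_pos hz _
    have e1 : (z ^ (-1/γ)) ^ (-γ) = z := by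
      rw [← Real.rpow_mul hz.le, show -1 / γ * -γ = 1 by field_simp, Real.rpow_one]
    have e2 : (z ^ (-1/γ)) ^ (1 - γ) = z ^ ((γ - 1)/γ) := by
      rw [← Real.rpow_mul hz.le]
      congr 1
      field_simp
      ring
    have e3 : z ^ ((γ - 1)/γ) = z ^ (-1/γ) * z := by
      rw [← e2, sub_eq_add_neg, Real.rpow_add ha, Real.rpow_one, e1]
    have hmem : z ^ (-1/γ) - L ∈ Set.Ici (0 : ℝ) := by
      rw [Set.mem_Ici, sub_nonneg]
      by_contra hlt
      push Not at hlt
      have := Real.rpow_le_rpow_of_nonpos ha hlt.le (by linarith : -γ ≤ 0)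
      rw [e1] at this
      linarith
    have hval : (z ^ (-1/γ) - L + L) ^ (1 - γ) / (1 - γ) - (z ^ (-1/γ) - L) * z
        = γ / (1 - γ) * z ^ ((γ - 1)/γ) + L * z := by
      rw [sub_add_cancel, e2, e3]
      field_simp
      ring
    refine ⟨⟨⟨_, hmem, hval⟩, ?_⟩, hmem, hval⟩
    rintro _ ⟨c, hc, rfl⟩
    have hc0 : 0 ≤ c := hc
    have h := crra_tangent γ _ (c + L) hγ hγ1 ha (by linarith)
    rw [e1] at h
    rw [← hval, sub_add_cancel]
    show (c + L) ^ (1 - γ) / (1 - γ) - c * z ≤ _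
    linarith
  · intro hzL
    have hval : ((0 : ℝ) + L) ^ (1 - γ) / (1 - γ) - 0 * z = L ^ (1 - γ) / (1 - γ) := by simp
    refine ⟨⟨⟨0, Set.self_mem_Ici, hval⟩, ?_⟩, hval⟩
    rintro _ ⟨c, hc, rfl⟩
    have hc0 : 0 ≤ c := hc
    have h := crra_tangent γ L (c + L) hγ hγ1 hL (by linarith)
    have h2 := mul_le_mul_of_nonneg_right hzL hc0
    rw [add_sub_cancel_right] at h
    show (c + L) ^ (1 - γ) / (1 - γ) - c * z ≤ _
    linarith
end

section
/- Let γ > 0 with γ ≠ 1, L > 0, and Y₁ > Y₂ ≥ 0 be real numbers, and let g be defined on (0, ∞) by g(z) := (Y₁−Y₂−L)·z for 0 < z < L^{−γ}, and g(z) := (γ/(1−γ))·z^{(γ−1)/γ} − (1/(1−γ))·L^{1−γ} + (Y₁−Y₂)·z for z ≥ L^{−γ}. Then g is convex on (0, ∞) and strictly convex on the interval [L^{−γ}, ∞). -/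
/-- The piecewise function g from the income-disaster retirement model. -/
noncomputable def gfun (γ L Y₁ Y₂ : ℝ) (z : ℝ) : ℝ :=
  if z < L ^ (-γ) then (Y₁ - Y₂ - L) * z
  else γ / (1 - γ) * z ^ ((γ - 1)/γ) - 1/(1 - γ) * L ^ (1 - γ) + (Y₁ - Y₂) * z

/-- The nonlinear part of g minus the linear part. -/
noncomputable def kfun (γ L z : ℝ) : ℝ :=
  γ / (1 - γ) * z ^ ((γ - 1)/γ) - 1/(1 - γ) * L ^ (1 - γ) + L * z

theorem kfun_props (γ L : ℝ) (hγ : 0 < γ) (hγ1 : γ ≠ 1) (hL : 0 < L) :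
    StrictConvexOn ℝ (Set.Ici (L ^ (-γ))) (kfun γ L) ∧
    MonotoneOn (kfun γ L) (Set.Ici (L ^ (-γ))) ∧ kfun γ L (L ^ (-γ)) = 0 := by
  have ha : 0 < L ^ (-γ) := Real.rpow_pos_of_pos hL _
  have h1 : (1 - γ) ≠ 0 := sub_ne_zero.2 hγ1.symm
  have hd : ∀ z, 0 < z → HasDerivAt (kfun γ L) (L - z ^ (-1/γ)) z := by
    intro z hz
    have h := (((Real.hasDerivAt_rpow_const (p := (γ - 1)/γ) (Or.inl hz.ne')).const_mul
      (γ / (1 - γ))).sub_const (1/(1 - γ) * L ^ (1 - γ))).add ((hasDerivAt_id z).const_mul L)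
    refine h.congr_deriv ?_
    have e : (γ - 1)/γ - 1 = -1/γ := by field_simp; ring
    rw [e]
    have e2 : γ / (1 - γ) * ((γ - 1)/γ) = -1 := by field_simp; ring
    rw [← mul_assoc, e2]; ring
  have hneg : -1/γ < 0 := div_neg_of_neg_of_pos (by norm_num) hγ
  have hc : ContinuousOn (kfun γ L) (Set.Ici (L ^ (-γ))) := fun z hz =>
    (hd z (ha.trans_le hz)).continuousAt.continuousWithinAt
  have hLa : (L ^ (-γ)) ^ (-1/γ) = L := by
    rw [← Real.rpow_mul hL.le]
    have : -γ * (-1/γ) = 1 := by field_simp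
    rw [this, Real.rpow_one]
  refine ⟨?_, ?_, ?_⟩
  · refine StrictMonoOn.strictConvexOn_of_deriv (convex_Ici _) hc ?_
    rw [interior_Ici]
    intro x hx y hy hxy
    have hx0 : 0 < x := ha.trans hx
    rw [(hd x hx0).deriv, (hd y (hx0.trans hxy)).deriv]
    have := Real.rpow_lt_rpow_of_neg hx0 hxy hneg
    linarith
  · refine monotoneOn_of_deriv_nonneg (convex_Ici _) hc ?_ ?_
    · rw [interior_Ici]
      exact fun z hz => (hd z (ha.trans hz)).differentiableAt.differentiableWithinAt
    · rw [interior_Ici]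
      intro z hz
      rw [(hd z (ha.trans hz)).deriv]
      have := Real.rpow_lt_rpow_of_neg ha hz hneg
      linarith
  · unfold kfun
    rw [← Real.rpow_mul hL.le]
    have e : -γ * ((γ - 1)/γ) = 1 - γ := by field_simp; ring
    have e2 : L * L ^ (-γ) = L ^ (1 - γ) := by
      rw [sub_eq_add_neg, Real.rpow_add hL, Real.rpow_one]
    rw [e, e2]
    field_simp
    ring

/-- g is convex on (0, ∞) and strictly convex on [L^{−γ}, ∞). -/
theorem gfun_convex (γ L Y₁ Y₂ : ℝ) (hγ : 0 < γ) (hγ1 : γ ≠ 1) (hL : 0 < L)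
    (hY : Y₁ > Y₂) (hY2 : Y₂ ≥ 0) :
    ConvexOn ℝ (Set.Ioi 0) (gfun γ L Y₁ Y₂) ∧
    StrictConvexOn ℝ (Set.Ici (L ^ (-γ))) (gfun γ L Y₁ Y₂) := by
  have ha : 0 < L ^ (-γ) := Real.rpow_pos_of_pos hL _
  obtain ⟨hk, hkm, hka⟩ := kfun_props γ L hγ hγ1 hL
  have hg : ∀ z, gfun γ L Y₁ Y₂ z = kfun γ L (max z (L ^ (-γ))) + (Y₁ - Y₂ - L) * z := by
    intro z
    unfold gfun
    split_ifs with h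
    · rw [max_eq_right h.le, hka]; ring
    · rw [max_eq_left (not_lt.1 h)]; unfold kfun; ring
  constructor
  · refine ⟨convex_Ioi 0, ?_⟩
    intro x hx y hy s t hs ht hst
    have h1 := hk.convexOn.2 (le_max_right x (L ^ (-γ))) (le_max_right y (L ^ (-γ))) hs ht hst
    have h4 : L ^ (-γ) ≤ s * max x (L ^ (-γ)) + t * max y (L ^ (-γ)) := by
      have e : L ^ (-γ) = s * L ^ (-γ) + t * L ^ (-γ) := by rw [← add_mul, hst, one_mul]
      calc L ^ (-γ) = s * L ^ (-γ) + t * L ^ (-γ) := e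
        _ ≤ _ := by gcongr <;> exact le_max_right _ _
    have h2 : max (s * x + t * y) (L ^ (-γ)) ≤ s * max x (L ^ (-γ)) + t * max y (L ^ (-γ)) := by
      refine max_le ?_ h4
      gcongr <;> exact le_max_left _ _
    have h3 := hkm (le_max_right (s * x + t * y) (L ^ (-γ))) h4 h2
    simp only [smul_eq_mul, hg] at *
    linarith
  · refine ⟨convex_Ici _, ?_⟩
    intro x hx y hy hxy s t hs ht hst
    have h1 := hk.2 hx hy hxy hs ht hst
    have h4 := convex_Ici (L ^ (-γ)) hx hy hs.le ht.le hst
    simp only [Set.mem_Ici] at hx hy h4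
    simp only [hg, max_eq_left hx, max_eq_left hy, max_eq_left h4]
    simp only [smul_eq_mul] at *
    linarith
end

section
/- Let γ > 0 with γ ≠ 1, L > 0, and Y₁ > Y₂ ≥ 0 be real numbers with L < Y₁ − Y₂, and let g be defined on (0, ∞) by g(z) := (Y₁−Y₂−L)·z for 0 < z < L^{−γ}, and g(z) := (γ/(1−γ))·z^{(γ−1)/γ} − (1/(1−γ))·L^{1−γ} + (Y₁−Y₂)·z for z ≥ L^{−γ}. Then g(z) > 0 for every z > 0. -/
/-- if the income support level is strictly below the income gap
(L < Y₁ − Y₂), then g(z) > 0 for every z > 0. -/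
theorem gfun_pos_of_support_below_gap (γ L Y₁ Y₂ : ℝ) (hγ : 0 < γ) (hγ1 : γ ≠ 1)
    (hL : 0 < L) (hY : Y₁ > Y₂) (hY2 : Y₂ ≥ 0) (hgap : L < Y₁ - Y₂) :
    ∀ z : ℝ, 0 < z → 0 < gfun γ L Y₁ Y₂ z := by
  intro z hz
  unfold gfun
  split_ifs with h
  · exact mul_pos (by linarith) hz
  have key : 0 ≤ γ / (1 - γ) * z ^ ((γ - 1)/γ) - 1/(1 - γ) * L ^ (1 - γ) + L * z := by
    have hA : 0 < z ^ ((γ - 1)/γ) := Real.rpow_pos_of_pos hz _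
    have hB : 0 < L ^ (1 - γ) := Real.rpow_pos_of_pos hL _
    have hW : 0 < L * z := mul_pos hL hz
    have hne : 1 - γ ≠ 0 := fun h0 => hγ1 (by linarith)
    rcases lt_or_gt_of_ne hγ1 with h1 | h1
    · have am := Real.geom_mean_le_arith_mean2_weighted (w₁ := 1 - γ) (w₂ := γ)
        (by linarith) hγ.le hW.le hA.le (by ring)
      have e : (L * z) ^ (1 - γ) * (z ^ ((γ - 1)/γ)) ^ γ = L ^ (1 - γ) := by
        rw [Real.mul_rpow hL.le hz.le, ← Real.rpow_mul hz.le, mul_assoc, ← Real.rpow_add hz,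
          div_mul_cancel₀ _ hγ.ne']
        simp
      rw [e] at am
      have hp : 0 < 1 - γ := by linarith
      have e2 : γ / (1 - γ) * z ^ ((γ - 1)/γ) - 1/(1 - γ) * L ^ (1 - γ) + L * z
          = ((1 - γ) * (L * z) + γ * z ^ ((γ - 1)/γ) - L ^ (1 - γ)) / (1 - γ) := by
        generalize z ^ ((γ - 1)/γ) = A
        generalize L ^ (1 - γ) = B
        field_simp
        ring
      rw [e2]
      exact div_nonneg (by linarith) hp.le
    · have hp : 0 < γ - 1 := by linarith
      have am := Real.geom_mean_le_arith_mean2_weighted (w₁ := (γ - 1) / γ) (w₂ := 1 / γ)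
        (by positivity) (by positivity) hW.le hB.le (by field_simp; ring)
      have e : (L * z) ^ ((γ - 1) / γ) * (L ^ (1 - γ)) ^ (1 / γ) = z ^ ((γ - 1)/γ) := by
        rw [Real.mul_rpow hL.le hz.le, ← Real.rpow_mul hL.le, mul_right_comm,
          ← Real.rpow_add hL]
        have : (γ - 1) / γ + (1 - γ) * (1 / γ) = 0 := by ring
        rw [this]
        simp
      rw [e] at am
      have e2 : γ / (1 - γ) * z ^ ((γ - 1)/γ) - 1/(1 - γ) * L ^ (1 - γ) + L * z
          = γ / (γ - 1) * ((γ - 1) / γ * (L * z) + 1 / γ * L ^ (1 - γ) - z ^ ((γ - 1)/γ)) := by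
        generalize z ^ ((γ - 1)/γ) = A
        generalize L ^ (1 - γ) = B
        have hne2 := hp.ne'
        have : 1 - γ = -(γ - 1) := by ring
        rw [this, div_neg, div_neg]
        field_simp
        ring
      rw [e2]
      exact mul_nonneg (by positivity) (by linarith)
  have : 0 < (Y₁ - Y₂ - L) * z := mul_pos (by linarith) hz
  linarith
end

section
/- Let γ > 0 with γ ≠ 1, L > 0, and Y₁ > Y₂ ≥ 0 be real numbers with L > Y₁ − Y₂, and let g be defined on (0, ∞) by g(z) := (Y₁−Y₂−L)·z for 0 < z < L^{−γ}, and g(z) := (γ/(1−γ))·z^{(γ−1)/γ} − (1/(1−γ))·L^{1−γ} + (Y₁−Y₂)·z for z ≥ L^{−γ}. Then there exists a unique j in the open interval (L^{−γ}, ∞) such that g(z) < 0 for all z in (0, j), g(j) = 0, and g(z) > 0 for all z in (j, ∞). -/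
/-- The second branch of `gfun`, as a function of the gap `a`. -/
noncomputable def hfun (γ L a z : ℝ) : ℝ :=
  γ / (1 - γ) * z ^ ((γ - 1)/γ) - 1/(1 - γ) * L ^ (1 - γ) + a * z

lemma hfun_hasDerivAt (γ L a z : ℝ) (hγ : 0 < γ) (hγ1 : γ ≠ 1) (hz : 0 < z) :
    HasDerivAt (hfun γ L a) (a - z ^ (-1/γ)) z := by
  have h1 : 1 - γ ≠ 0 := sub_ne_zero.2 (Ne.symm hγ1)
  have h := (((Real.hasDerivAt_rpow_const (p := (γ - 1)/γ) (Or.inl hz.ne')).const_mul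
    (γ / (1 - γ))).sub_const (1/(1 - γ) * L ^ (1 - γ))).add ((hasDerivAt_id z).const_mul a)
  have e : (γ - 1)/γ - 1 = -1/γ := by field_simp; ring
  rw [e] at h
  refine h.congr_deriv ?_
  field_simp
  ring

lemma hfun_convexOn (γ L a : ℝ) (hγ : 0 < γ) (hγ1 : γ ≠ 1) :
    ConvexOn ℝ (Set.Ioi 0) (hfun γ L a) := by
  have hd := fun z (hz : z ∈ Set.Ioi (0:ℝ)) => hfun_hasDerivAt γ L a z hγ hγ1 hz
  refine MonotoneOn.convexOn_of_deriv (convex_Ioi 0)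
    (fun z hz => (hd z hz).continuousAt.continuousWithinAt) ?_ ?_
  · rw [interior_Ioi]
    exact fun z hz => (hd z hz).differentiableAt.differentiableWithinAt
  · rw [interior_Ioi]
    intro x hx y hy hxy
    rw [(hd x hx).deriv, (hd y hy).deriv]
    have : y ^ (-1/γ) ≤ x ^ (-1/γ) :=
      Real.rpow_le_rpow_of_nonpos hx hxy (div_nonpos_of_nonpos_of_nonneg (by norm_num) hγ.le)
    linarith

lemma pow_aux (γ B : ℝ) (hγ : 0 < γ) (hB : 0 < B) :
    (B ^ (-γ)) ^ ((γ - 1)/γ) = B ^ (1 - γ) ∧ B ^ (1 - γ) = B * B ^ (-γ) := by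
  constructor
  · rw [← Real.rpow_mul hB.le]
    congr 1
    field_simp
    ring
  · rw [show 1 - γ = 1 + -γ by ring, Real.rpow_add hB, Real.rpow_one]

lemma hfun_left (γ L a : ℝ) (hγ : 0 < γ) (hγ1 : γ ≠ 1) (hL : 0 < L) :
    hfun γ L a (L ^ (-γ)) = (a - L) * L ^ (-γ) := by
  have h1 : 1 - γ ≠ 0 := sub_ne_zero.2 (Ne.symm hγ1)
  obtain ⟨e1, e2⟩ := pow_aux γ L hγ hL
  rw [hfun, e1, e2]
  field_simp
  ring

lemma hfun_right (γ L a : ℝ) (hγ : 0 < γ) (hγ1 : γ ≠ 1) (hL : 0 < L) (ha : 0 < a)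
    (haL : a < L) : ∃ M, L ^ (-γ) < M ∧ 0 ≤ hfun γ L a M := by
  have hc : 0 < L ^ (-γ) := Real.rpow_pos_of_pos hL _
  have hk : 0 < L ^ (1 - γ) := Real.rpow_pos_of_pos hL _
  rcases lt_or_gt_of_ne hγ1 with h | h
  · have h1 : 0 < 1 - γ := by linarith
    have hK : 0 < 1/(1 - γ) * L ^ (1 - γ) := by positivity
    refine ⟨L ^ (-γ) + 1/(1 - γ) * L ^ (1 - γ) / a, ?_, ?_⟩
    · have : 0 < 1/(1 - γ) * L ^ (1 - γ) / a := div_pos hK ha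
      linarith
    · rw [hfun, mul_add, mul_div_cancel₀ _ ha.ne']
      have : 0 ≤ γ / (1 - γ) * (L ^ (-γ) + 1/(1 - γ) * L ^ (1 - γ) / a) ^ ((γ - 1)/γ) := by
        positivity
      nlinarith [mul_pos ha hc]
  · have h1 : 0 < γ - 1 := by linarith
    have h1' : 1 - γ ≠ 0 := by linarith
    have hB : 0 < a * (γ - 1) / γ := by positivity
    refine ⟨(a * (γ - 1) / γ) ^ (-γ), ?_, ?_⟩
    · refine Real.rpow_lt_rpow_of_neg hB ?_ (by linarith)
      rw [div_lt_iff₀ hγ]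
      nlinarith
    · obtain ⟨e1, e2⟩ := pow_aux γ _ hγ hB
      rw [hfun, e1, e2]
      have e3 : γ / (1 - γ) * (a * (γ - 1) / γ * (a * (γ - 1) / γ) ^ (-γ))
          = - (a * (a * (γ - 1) / γ) ^ (-γ)) := by
        generalize (a * (γ - 1) / γ) ^ (-γ) = t
        field_simp
        ring
      have e4 : 1 / (1 - γ) * L ^ (1 - γ) ≤ 0 :=
        mul_nonpos_of_nonpos_of_nonneg (div_nonpos_of_nonneg_of_nonpos (by norm_num)
          (by linarith)) hk.le
      rw [e3]
      linarith

/-- if the income support level strictly exceeds the income gap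
(L > Y₁ − Y₂), then there exists a unique j ∈ (L^{−γ}, ∞) such that g < 0 on (0, j),
g(j) = 0, and g > 0 on (j, ∞). -/
theorem gfun_unique_zero_of_support_above_gap (γ L Y₁ Y₂ : ℝ) (hγ : 0 < γ) (hγ1 : γ ≠ 1)
    (hL : 0 < L) (hY : Y₁ > Y₂) (hY2 : Y₂ ≥ 0) (hgap : L > Y₁ - Y₂) :
    ∃! j : ℝ, j ∈ Set.Ioi (L ^ (-γ)) ∧
      (∀ z : ℝ, 0 < z → z < j → gfun γ L Y₁ Y₂ z < 0) ∧
      gfun γ L Y₁ Y₂ j = 0 ∧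
      (∀ z : ℝ, j < z → 0 < gfun γ L Y₁ Y₂ z) := by
  have hc : 0 < L ^ (-γ) := Real.rpow_pos_of_pos hL _
  have hg : ∀ z, L ^ (-γ) ≤ z → gfun γ L Y₁ Y₂ z = hfun γ L (Y₁ - Y₂) z := by
    intro z hz
    rw [gfun, if_neg (not_lt.2 hz), hfun]
  have hneg : hfun γ L (Y₁ - Y₂) (L ^ (-γ)) < 0 := by
    rw [hfun_left γ L _ hγ hγ1 hL]
    exact mul_neg_of_neg_of_pos (by linarith) hc
  obtain ⟨M, hM, hM0⟩ := hfun_right γ L (Y₁ - Y₂) hγ hγ1 hL (by linarith) hgap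
  have hconv := hfun_convexOn γ L (Y₁ - Y₂) hγ hγ1
  have hcont : ContinuousOn (hfun γ L (Y₁ - Y₂)) (Set.Icc (L ^ (-γ)) M) := fun z hz =>
    (hfun_hasDerivAt γ L _ z hγ hγ1 (hc.trans_le hz.1)).continuousAt.continuousWithinAt
  obtain ⟨j, hj, hj0⟩ := intermediate_value_Icc hM.le hcont ⟨hneg.le, hM0⟩
  have hcj : L ^ (-γ) < j := by
    refine lt_of_le_of_ne hj.1 ?_
    rintro rfl
    exact hneg.ne hj0
  -- chord inequality from convexity
  have chord : ∀ y z, L ^ (-γ) < y → y < z →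
      (z - L ^ (-γ)) * hfun γ L (Y₁ - Y₂) y ≤ (z - y) * hfun γ L (Y₁ - Y₂) (L ^ (-γ))
        + (y - L ^ (-γ)) * hfun γ L (Y₁ - Y₂) z := by
    intro y z h1 h2
    have := hconv.slope_mono_adjacent (Set.mem_Ioi.2 hc)
      (Set.mem_Ioi.2 (hc.trans (h1.trans h2))) h1 h2
    rw [div_le_div_iff₀ (by linarith) (by linarith)] at this
    nlinarith
  refine ⟨j, ⟨hcj, ?_, ?_, ?_⟩, ?_⟩
  · intro z hz hzj
    rcases lt_trichotomy z (L ^ (-γ)) with h | h | h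
    · rw [gfun, if_pos h]
      exact mul_neg_of_neg_of_pos (by linarith) hz
    · rw [hg z h.ge, h]
      exact hneg
    · rw [hg z h.le]
      have := chord z j h hzj
      rw [hj0] at this
      by_contra! hcon
      nlinarith [mul_nonneg (by linarith : 0 ≤ j - L ^ (-γ)) hcon,
        mul_neg_of_pos_of_neg (by linarith : 0 < j - z) hneg]
  · rw [hg j hcj.le, hj0]
  · intro z hz
    rw [hg z (hcj.trans hz).le]
    have := chord j z hcj hz
    rw [hj0] at this
    by_contra! hcon
    nlinarith [mul_nonpos_of_nonneg_of_nonpos (by linarith : 0 ≤ j - L ^ (-γ)) hcon,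
      mul_neg_of_pos_of_neg (by linarith : 0 < z - j) hneg]
  · rintro k ⟨hk, hk1, hk2, hk3⟩
    have hj0' : gfun γ L Y₁ Y₂ j = 0 := by rw [hg j hcj.le, hj0]
    rcases lt_trichotomy k j with h | h | h
    · exact absurd hj0' (hk3 j h).ne'
    · exact h
    · exact absurd hj0' (hk1 j (hc.trans hcj) h).ne
end

section
/- Let γ > 0 with γ ≠ 1, L > 0, Y₁ > Y₂ ≥ 0, and m₊ > 1 be real numbers with L > Y₁ − Y₂, and let g be defined on (0, ∞) by g(z) := (Y₁−Y₂−L)·z for 0 < z < L^{−γ}, and g(z) := (γ/(1−γ))·z^{(γ−1)/γ} − (1/(1−γ))·L^{1−γ} + (Y₁−Y₂)·z for z ≥ L^{−γ}. Then F(z) := ∫_z^∞ y^{−1−m₊} g(y) dy tends to −∞ as z → 0⁺. -/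
/-- F(z) := ∫_z^∞ y^{−1−m₊} g(y) dy. -/
noncomputable def Ffun (γ L Y₁ Y₂ mp : ℝ) (z : ℝ) : ℝ :=
  ∫ y in Set.Ioi z, y ^ (-1 - mp) * gfun γ L Y₁ Y₂ y

/-- if L > Y₁ − Y₂, then F(z) := ∫_z^∞ y^{−1−m₊} g(y) dy tends to −∞
as z → 0⁺. -/
theorem Ffun_tendsto_atBot (γ L Y₁ Y₂ mp : ℝ) (hγ : 0 < γ) (hγ1 : γ ≠ 1) (hL : 0 < L)
    (hY : Y₁ > Y₂) (hY2 : Y₂ ≥ 0) (hgap : L > Y₁ - Y₂) (hmp : mp > 1) :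
    Filter.Tendsto (Ffun γ L Y₁ Y₂ mp) (nhdsWithin 0 (Set.Ioi 0)) Filter.atBot := by
  classical
  have hc : 0 < L ^ (-γ) := Real.rpow_pos_of_pos hL _
  set c := L ^ (-γ) with hcdef
  set k := L - (Y₁ - Y₂) with hk
  have hkpos : 0 < k := by rw [hk]; linarith
  set G : ℝ → ℝ := fun y => y ^ (-1 - mp) * gfun γ L Y₁ Y₂ y + k * y ^ (-mp) with hG
  have hmul : ∀ y : ℝ, 0 < y → y ^ (-1 - mp) * y = y ^ (-mp) := by
    intro y hy
    rw [← Real.rpow_add_one hy.ne']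
    congr 1
    ring
  have hG0 : ∀ y : ℝ, 0 < y → y < c → G y = 0 := by
    intro y hy hyc
    simp only [hG, gfun]
    rw [if_pos hyc, ← hmul y hy, hk]
    ring
  have hGI : MeasureTheory.IntegrableOn G (Set.Ici c) := by
    rw [integrableOn_Ici_iff_integrableOn_Ioi]
    have e1 : -1 - mp + (γ - 1) / γ < -1 := by
      have h1 : (γ - 1) / γ = 1 - 1 / γ := by field_simp
      have h2 : 0 < 1 / γ := by positivity
      rw [h1]; linarith
    have i1 := (integrableOn_Ioi_rpow_of_lt e1 hc).const_mul (γ / (1 - γ))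
    have i2 := (integrableOn_Ioi_rpow_of_lt (show -1 - mp < -1 by linarith) hc).const_mul
      (1 / (1 - γ) * L ^ (1 - γ))
    have i3 := (integrableOn_Ioi_rpow_of_lt (show -mp < -1 by linarith) hc).const_mul
      (Y₁ - Y₂ + k)
    refine MeasureTheory.IntegrableOn.congr_fun ((i1.sub i2).add i3) ?_ measurableSet_Ioi
    intro y hy
    have hyc : c < y := hy
    have hy0 : 0 < y := hc.trans hyc
    simp only [hG, gfun, Pi.add_apply, Pi.sub_apply]
    rw [if_neg (not_lt.mpr hyc.le), Real.rpow_add hy0, ← hmul y hy0]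
    ring
  have key : ∀ z : ℝ, 0 < z → z < c →
      Ffun γ L Y₁ Y₂ mp z = (∫ y in Set.Ici c, G y) + (-(k / (mp - 1))) * z ^ (-(mp - 1)) := by
    intro z hz hzc
    have hsub : Set.Ici c ⊆ Set.Ioi z := fun y hy => lt_of_lt_of_le hzc hy
    have hz0 : ∀ y ∈ Set.Ioi z \ Set.Ici c, G y = 0 := by
      rintro y ⟨hy, hy2⟩
      exact hG0 y (hz.trans hy) (not_le.mp hy2)
    have hI : MeasureTheory.IntegrableOn G (Set.Ioi z) :=
      hGI.of_forall_diff_eq_zero measurableSet_Ioi hz0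
    have hE := MeasureTheory.setIntegral_eq_of_subset_of_forall_diff_eq_zero
      (μ := MeasureTheory.volume) measurableSet_Ioi hsub hz0
    have i3 := (integrableOn_Ioi_rpow_of_lt (show -mp < -1 by linarith) hz).const_mul k
    have hF : Ffun γ L Y₁ Y₂ mp z = ∫ y in Set.Ioi z, (G y - k * y ^ (-mp)) := by
      unfold Ffun
      congr 1
      funext y
      simp only [hG]
      ring
    rw [hF, MeasureTheory.integral_sub hI i3, hE, MeasureTheory.integral_const_mul,
      integral_Ioi_rpow_of_lt (show -mp < -1 by linarith) hz]
    have e : -mp + 1 = -(mp - 1) := by ring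
    rw [e, neg_div_neg_eq]
    ring
  have hT : Filter.Tendsto
      (fun z : ℝ => (∫ y in Set.Ici c, G y) + (-(k / (mp - 1))) * z ^ (-(mp - 1)))
      (nhdsWithin 0 (Set.Ioi 0)) Filter.atBot := by
    apply Filter.tendsto_atBot_add_const_left
    apply Filter.Tendsto.const_mul_atTop_of_neg
    · have : 0 < k / (mp - 1) := div_pos hkpos (by linarith)
      linarith
    · exact tendsto_rpow_neg_nhdsGT_zero (by linarith)
  refine hT.congr' ?_
  filter_upwards [Ioo_mem_nhdsGT hc] with z hz
  exact (key z hz.1 hz.2).symm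
end

section
/- Let γ > 0 with γ ≠ 1, L > 0, Y₁ > Y₂ ≥ 0, and m₊ > 1 be real numbers with L > Y₁ − Y₂, let g be defined on (0, ∞) by g(z) := (Y₁−Y₂−L)·z for 0 < z < L^{−γ}, and g(z) := (γ/(1−γ))·z^{(γ−1)/γ} − (1/(1−γ))·L^{1−γ} + (Y₁−Y₂)·z for z ≥ L^{−γ}, and let j ∈ (L^{−γ}, ∞) be the unique zero of g. Then F(z) := ∫_z^∞ y^{−1−m₊} g(y) dy is strictly increasing on (0, j], and there exists a unique z̄ ∈ (0, j) such that F(z̄) = 0 (the dual retirement threshold). -/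
lemma aux_integrable (γ L Y₁ Y₂ mp : ℝ) (hγ : 0 < γ) (hmp : mp > 1) (z : ℝ) (hz : 0 < z) :
    MeasureTheory.IntegrableOn (fun y => y ^ (-1 - mp) * gfun γ L Y₁ Y₂ y) (Set.Ioi z) := by
  have hp : (γ - 1) / γ < 1 := by rw [div_lt_one hγ]; linarith
  have i1 : MeasureTheory.IntegrableOn (fun y : ℝ => y ^ (-mp)) (Set.Ioi z) :=
    integrableOn_Ioi_rpow_of_lt (by linarith) hz
  have i2 : MeasureTheory.IntegrableOn (fun y : ℝ => y ^ (-1 - mp)) (Set.Ioi z) :=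
    integrableOn_Ioi_rpow_of_lt (by linarith) hz
  have i3 : MeasureTheory.IntegrableOn (fun y : ℝ => y ^ (-1 - mp + (γ - 1) / γ)) (Set.Ioi z) :=
    integrableOn_Ioi_rpow_of_lt (by linarith) hz
  have f1 : MeasureTheory.IntegrableOn (fun y : ℝ => (Y₁ - Y₂ - L) * y ^ (-mp)) (Set.Ioi z) :=
    i1.const_mul _
  have f2 : MeasureTheory.IntegrableOn (fun y : ℝ => γ / (1 - γ) * y ^ (-1 - mp + (γ - 1) / γ)
      - 1/(1 - γ) * L ^ (1 - γ) * y ^ (-1 - mp) + (Y₁ - Y₂) * y ^ (-mp)) (Set.Ioi z) :=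
    ((i3.const_mul _).sub (i2.const_mul _)).add (i1.const_mul _)
  have f3 := MeasureTheory.Integrable.piecewise (s := Set.Iio (L ^ (-γ))) measurableSet_Iio
    f1.integrableOn f2.integrableOn
  refine MeasureTheory.IntegrableOn.congr_fun f3 ?_ measurableSet_Ioi
  intro y hy
  have hy0 : 0 < y := lt_trans hz hy
  have e1 : y ^ (-mp) = y ^ (-1 - mp) * y := by
    rw [← Real.rpow_add_one hy0.ne']; congr 1; ring
  by_cases h : y < L ^ (-γ)
  · simp only [Set.piecewise, Set.mem_Iio, h, gfun, if_true, e1]; ring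
  · simp only [Set.piecewise, Set.mem_Iio, h, gfun, if_false, e1, Real.rpow_add hy0]; ring

/-- if L > Y₁ − Y₂ : strict monotonicity of F and the unique dual retirement threshold. -/
theorem Ffun_strictMono_and_unique_zero (γ L Y₁ Y₂ mp j : ℝ) (hγ : 0 < γ) (hγ1 : γ ≠ 1)
    (hL : 0 < L) (hY : Y₁ > Y₂) (hY2 : Y₂ ≥ 0) (hgap : L > Y₁ - Y₂) (hmp : mp > 1)
    (hj : j ∈ Set.Ioi (L ^ (-γ)))
    (hneg : ∀ z : ℝ, 0 < z → z < j → gfun γ L Y₁ Y₂ z < 0)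
    (hzero : gfun γ L Y₁ Y₂ j = 0)
    (hpos : ∀ z : ℝ, j < z → 0 < gfun γ L Y₁ Y₂ z) :
    StrictMonoOn (Ffun γ L Y₁ Y₂ mp) (Set.Ioc 0 j) ∧
    ∃! zbar : ℝ, zbar ∈ Set.Ioo 0 j ∧ Ffun γ L Y₁ Y₂ mp zbar = 0 := by
  have hb : 0 < L ^ (-γ) := Real.rpow_pos_of_pos hL _
  have hbj : L ^ (-γ) < j := hj
  have hj0 : 0 < j := hb.trans hbj
  set f : ℝ → ℝ := fun y => y ^ (-1 - mp) * gfun γ L Y₁ Y₂ y with hf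
  have hint : ∀ z, 0 < z → MeasureTheory.IntegrableOn f (Set.Ioi z) :=
    fun z hz => aux_integrable γ L Y₁ Y₂ mp hγ hmp z hz
  have hii : ∀ x y, 0 < x → x ≤ y → IntervalIntegrable f MeasureTheory.volume x y := by
    intro x y hx hxy
    rw [intervalIntegrable_iff_integrableOn_Ioc_of_le hxy]
    exact (hint x hx).mono_set Set.Ioc_subset_Ioi_self
  have hsplit : ∀ x y, 0 < x → x ≤ y →
      Ffun γ L Y₁ Y₂ mp x = (∫ t in x..y, f t) + Ffun γ L Y₁ Y₂ mp y := by
    intro x y hx hxy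
    exact (intervalIntegral.integral_interval_add_Ioi (hint x hx) (hint y (hx.trans_le hxy))).symm
  have hmono : StrictMonoOn (Ffun γ L Y₁ Y₂ mp) (Set.Ioc 0 j) := by
    intro x hx y hy hxy
    rw [hsplit x y hx.1 hxy.le]
    have := intervalIntegral.intervalIntegral_pos_of_pos_on (f := fun t => - f t)
      (hii x y hx.1 hxy.le).neg (by
        intro t ht
        have ht0 : 0 < t := hx.1.trans ht.1
        have h1 := hneg t ht0 (ht.2.trans_le hy.2)
        have h2 := Real.rpow_pos_of_pos ht0 (-1 - mp)
        have := mul_neg_of_pos_of_neg h2 h1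
        simp only [hf]; linarith) hxy
    rw [intervalIntegral.integral_neg] at this
    linarith
  refine ⟨hmono, ?_⟩
  have hfpos : ∀ t, j < t → 0 < f t := fun t ht =>
    mul_pos (Real.rpow_pos_of_pos (hj0.trans ht) _) (hpos t ht)
  have hFj : 0 < Ffun γ L Y₁ Y₂ mp j := by
    rw [hsplit j (j+1) hj0 (by linarith)]
    have h1 := intervalIntegral.intervalIntegral_pos_of_pos_on
      (hii j (j+1) hj0 (by linarith)) (fun t ht => hfpos t ht.1) (by linarith)
    have h2 : 0 ≤ Ffun γ L Y₁ Y₂ mp (j+1) := by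
      apply MeasureTheory.setIntegral_nonneg measurableSet_Ioi
      intro t ht
      exact (hfpos t (by have : j + 1 < t := ht
                         linarith)).le
    linarith
  set c := L ^ (-γ) / 2 with hc
  have hc0 : 0 < c := by positivity
  have hcb : c < L ^ (-γ) := by linarith
  have hform : ∀ z, 0 < z → z ≤ c → Ffun γ L Y₁ Y₂ mp z =
      (Y₁ - Y₂ - L) * ((c ^ (-mp + 1) - z ^ (-mp + 1)) / (-mp + 1)) + Ffun γ L Y₁ Y₂ mp c := by
    intro z hz hzc
    rw [hsplit z c hz hzc]
    congr 1
    rw [← integral_rpow (Or.inr ⟨by linarith, by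
      rw [Set.uIcc_of_le hzc]; intro h; exact absurd h.1 (by linarith)⟩),
      ← intervalIntegral.integral_const_mul]
    apply intervalIntegral.integral_congr
    intro y hy
    rw [Set.uIcc_of_le hzc] at hy
    have hy0 : 0 < y := hz.trans_le hy.1
    have e1 : y ^ (-mp) = y ^ (-1 - mp) * y := by
      rw [← Real.rpow_add_one hy0.ne']; congr 1; ring
    simp only [hf, gfun, if_pos (hy.2.trans_lt hcb), e1]
    ring
  obtain ⟨z, hz0, hzc, hFz⟩ : ∃ z, 0 < z ∧ z ≤ c ∧ Ffun γ L Y₁ Y₂ mp z < 0 := by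
    have ht : Filter.Tendsto (fun z : ℝ => z ^ (-mp + 1)) (nhdsWithin 0 (Set.Ioi 0)) Filter.atTop :=
      tendsto_rpow_neg_nhdsGT_zero (by linarith)
    have e1 := ht.eventually_gt_atTop
      (c ^ (-mp + 1) + Ffun γ L Y₁ Y₂ mp c * (mp - 1) / (L - (Y₁ - Y₂)))
    have e2 : ∀ᶠ z in nhdsWithin (0:ℝ) (Set.Ioi 0), z ∈ Set.Ioc 0 c := Ioc_mem_nhdsGT hc0
    obtain ⟨z, h1, h2⟩ := (e1.and e2).exists
    refine ⟨z, h2.1, h2.2, ?_⟩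
    rw [hform z h2.1 h2.2]
    have hK : 0 < L - (Y₁ - Y₂) := by linarith
    have hm : 0 < mp - 1 := by linarith
    have h3 : Ffun γ L Y₁ Y₂ mp c * (mp - 1) / (L - (Y₁ - Y₂)) < z ^ (-mp + 1) - c ^ (-mp + 1) := by
      linarith
    rw [div_lt_iff₀ hK] at h3
    have h4 : (Y₁ - Y₂ - L) * ((c ^ (-mp + 1) - z ^ (-mp + 1)) / (-mp + 1)) =
      - ((z ^ (-mp + 1) - c ^ (-mp + 1)) * (L - (Y₁ - Y₂)) / (mp - 1)) := by
      have : -mp + 1 ≠ 0 := by linarith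
      have : mp - 1 ≠ 0 := hm.ne'
      rw [show -mp + 1 = -(mp - 1) by ring]
      field_simp
      ring
    rw [h4]
    have := (lt_div_iff₀ hm).2 h3
    linarith
  have hzj : z < j := by linarith
  have hcont : ContinuousOn (Ffun γ L Y₁ Y₂ mp) (Set.Icc z j) := by
    have h1 : ContinuousOn (fun x => ∫ t in x..j, f t) (Set.uIcc z j) :=
      intervalIntegral.continuousOn_primitive_interval_left (by
        rw [Set.uIcc_of_le hzj.le, integrableOn_Icc_iff_integrableOn_Ioc]
        exact (hint z hz0).mono_set Set.Ioc_subset_Ioi_self)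
    rw [Set.uIcc_of_le hzj.le] at h1
    refine (h1.add (continuousOn_const (c := Ffun γ L Y₁ Y₂ mp j))).congr ?_
    intro x hx
    exact hsplit x j (hz0.trans_le hx.1) hx.2
  obtain ⟨w, hw, hw0⟩ := intermediate_value_Ioo hzj.le hcont ⟨hFz, hFj⟩
  refine ⟨w, ⟨⟨hz0.trans hw.1, hw.2⟩, hw0⟩, ?_⟩
  rintro v ⟨hv, hv0⟩
  exact hmono.injOn ⟨hv.1, hv.2.le⟩ ⟨hz0.trans hw.1, hw.2.le⟩ (hv0.trans hw0.symm)
end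

section
/- Let γ > 0 with γ ≠ 1, L > 0, Y₁ > Y₂ ≥ 0, and m₊ > 1 be real numbers with L ≤ Y₁ − Y₂, and let g be defined on (0, ∞) by g(z) := (Y₁−Y₂−L)·z for 0 < z < L^{−γ}, and g(z) := (γ/(1−γ))·z^{(γ−1)/γ} − (1/(1−γ))·L^{1−γ} + (Y₁−Y₂)·z for z ≥ L^{−γ}. Then F(z) := ∫_z^∞ y^{−1−m₊} g(y) dy satisfies F(z) > 0 for every z > 0; in particular, the threshold equation F(z̄) = 0 has no solution z̄ > 0 (so retirement is optimally delayed forever when the income support level does not exceed the income gap). -/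
open MeasureTheory Set in
lemma aux_bern (p t : ℝ) (hp0 : p ≠ 0) (hp : p < 1) (ht : 1 < t) : (t ^ p - 1) / p < t - 1 := by
  have h : StrictMonoOn (fun t : ℝ => t - 1 - (t ^ p - 1) / p) (Ici 1) := by
    have hd : ∀ x : ℝ, 1 ≤ x →
        HasDerivAt (fun t : ℝ => t - 1 - (t ^ p - 1) / p) (1 - (p * x ^ (p - 1)) / p) x := by
      intro x hx
      exact ((hasDerivAt_id x).sub_const 1).sub
        (((Real.hasDerivAt_rpow_const (Or.inl (by linarith))).sub_const 1).div_const p)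
    apply strictMonoOn_of_deriv_pos (convex_Ici 1)
    · intro x hx
      exact (hd x hx).continuousAt.continuousWithinAt
    · intro x hx
      rw [interior_Ici] at hx
      rw [(hd x (le_of_lt hx)).deriv, mul_div_cancel_left₀ _ hp0]
      have := Real.rpow_lt_one_of_one_lt_of_neg hx (by linarith : p - 1 < 0)
      linarith
  have := h (mem_Ici.2 le_rfl) (mem_Ici.2 ht.le) ht
  simp at this
  linarith

lemma aux_upper (γ L D z : ℝ) (hγ : 0 < γ) (hγ1 : γ ≠ 1) (hL : 0 < L) (hD : L ≤ D)
    (hz : L ^ (-γ) < z) :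
    0 < γ / (1 - γ) * z ^ ((γ - 1)/γ) - 1/(1 - γ) * L ^ (1 - γ) + D * z := by
  have ha : 0 < L ^ (-γ) := Real.rpow_pos_of_pos hL _
  have h1 : (1 - γ) ≠ 0 := fun h => hγ1 (by linarith)
  have h1' : (γ - 1) ≠ 0 := fun h => hγ1 (by linarith)
  have ht : 1 < z / L ^ (-γ) := (one_lt_div ha).2 hz
  have hb := aux_bern ((γ - 1)/γ) (z / L ^ (-γ)) (div_ne_zero h1' hγ.ne')
    (by rw [div_lt_one hγ]; linarith) ht
  have e1 : L ^ (1 - γ) = L * L ^ (-γ) := by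
    rw [sub_eq_add_neg, Real.rpow_add hL, Real.rpow_one]
  have e2 : z = z / L ^ (-γ) * L ^ (-γ) := by field_simp
  have e3 : (L ^ (-γ)) ^ ((γ - 1)/γ) = L * L ^ (-γ) := by
    rw [← Real.rpow_mul hL.le, ← e1]
    congr 1
    field_simp
    ring
  generalize hT : z / L ^ (-γ) = t at *
  have e4 : z ^ ((γ - 1)/γ) = t ^ ((γ - 1)/γ) * (L * L ^ (-γ)) := by
    rw [e2, Real.mul_rpow (by linarith) ha.le, e3]
  rw [e4, e1]
  have hm := mul_lt_mul_of_pos_right hb (mul_pos hL ha)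
  have hDz : L * z ≤ D * z := mul_le_mul_of_nonneg_right hD (by linarith)
  generalize t ^ ((γ - 1)/γ) = u at *
  generalize L ^ (-γ) = a at *
  have e5 : γ / (1 - γ) * (u * (L * a)) - 1/(1 - γ) * (L * a)
      = - ((u - 1) / ((γ - 1) / γ) * (L * a)) - L * a := by
    have : (γ - 1) = - (1 - γ) := by ring
    rw [this]
    field_simp
    ring
  rw [e5]
  have e6 : L * z = t * (L * a) := by rw [e2]; ring
  linarith

open MeasureTheory Set in
lemma aux_int (γ L Y₁ Y₂ mp z : ℝ) (hγ : 0 < γ) (hmp : mp > 1) (hz : 0 < z) :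
    IntegrableOn (fun y => y ^ (-1 - mp) * gfun γ L Y₁ Y₂ y) (Ioi z) := by
  have hp : (γ - 1) / γ < 1 := by rw [div_lt_one hγ]; linarith
  have i1 : IntegrableOn (fun y : ℝ => y ^ (-1 - mp) * y) (Ioi z) := by
    refine (integrableOn_Ioi_rpow_of_lt (a := -1 - mp + 1) (by linarith) hz).congr_fun ?_
      measurableSet_Ioi
    intro y hy
    exact Real.rpow_add_one (hz.trans hy).ne' _
  have i2 : IntegrableOn (fun y : ℝ => y ^ (-1 - mp) * y ^ ((γ - 1) / γ)) (Ioi z) := by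
    refine (integrableOn_Ioi_rpow_of_lt (a := -1 - mp + (γ - 1) / γ) (by linarith) hz).congr_fun ?_
      measurableSet_Ioi
    intro y hy
    exact Real.rpow_add (hz.trans hy) _ _
  have i3 : IntegrableOn (fun y : ℝ => y ^ (-1 - mp)) (Ioi z) :=
    integrableOn_Ioi_rpow_of_lt (by linarith) hz
  have A : IntegrableOn (fun y : ℝ => (Y₁ - Y₂ - L) * (y ^ (-1 - mp) * y)) (Ioi z) :=
    i1.const_mul _
  have B : IntegrableOn (fun y : ℝ => γ / (1 - γ) * (y ^ (-1 - mp) * y ^ ((γ - 1) / γ))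
      - 1/(1 - γ) * L ^ (1 - γ) * y ^ (-1 - mp) + (Y₁ - Y₂) * (y ^ (-1 - mp) * y)) (Ioi z) :=
    ((i2.const_mul _).sub (i3.const_mul _)).add (i1.const_mul _)
  have C := Integrable.piecewise (s := Iio (L ^ (-γ))) measurableSet_Iio
    (Integrable.integrableOn A) (Integrable.integrableOn B)
  refine Integrable.congr C (Filter.Eventually.of_forall fun y => ?_)
  by_cases h : y < L ^ (-γ)
  · rw [piecewise_eq_of_mem _ _ _ (mem_Iio.2 h)]
    simp only [gfun, if_pos h]; ring
  · rw [piecewise_eq_of_notMem _ _ _ (by simpa using h)]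
    simp only [gfun, if_neg h]; ring

open MeasureTheory Set in
lemma aux_pos (γ L Y₁ Y₂ mp : ℝ) (hγ : 0 < γ) (hγ1 : γ ≠ 1)
    (hL : 0 < L) (hgap : L ≤ Y₁ - Y₂) (hmp : mp > 1) (z : ℝ) (hz : 0 < z) :
    0 < Ffun γ L Y₁ Y₂ mp z := by
  have hpos : ∀ y, z < y → L ^ (-γ) < y → 0 < y ^ (-1 - mp) * gfun γ L Y₁ Y₂ y := by
    intro y hy h
    refine mul_pos (Real.rpow_pos_of_pos (hz.trans hy) _) ?_
    rw [gfun, if_neg (not_lt.2 h.le)]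
    exact aux_upper γ L (Y₁ - Y₂) y hγ hγ1 hL hgap h
  unfold Ffun
  rw [setIntegral_pos_iff_support_of_nonneg_ae _ (aux_int γ L Y₁ Y₂ mp z hγ hmp hz)]
  · refine lt_of_lt_of_le (b := volume (Ioi (max z (L ^ (-γ))))) (by simp) (measure_mono ?_)
    intro y hy
    have h := max_lt_iff.1 (mem_Ioi.1 hy)
    exact ⟨(hpos y h.1 h.2).ne', h.1⟩
  · have hne : ∀ᵐ y ∂(volume.restrict (Ioi z)), y ≠ L ^ (-γ) :=
      Measure.ae_ne _ _
    filter_upwards [hne, ae_restrict_mem measurableSet_Ioi] with y h1 h2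
    have h2 : z < y := h2
    rcases lt_or_gt_of_ne h1 with h | h
    · have := Real.rpow_nonneg (hz.trans h2).le (-1 - mp)
      simp only [gfun, if_pos h, Pi.zero_apply]
      exact mul_nonneg this (mul_nonneg (by linarith) (hz.trans h2).le)
    · exact (hpos y h2 h).le

/-- if the income support does not exceed the income gap (L ≤ Y₁ − Y₂),
then F(z) > 0 for every z > 0; in particular the threshold equation F(z̄) = 0 has no
solution z̄ > 0 (retirement is optimally delayed forever). -/
theorem Ffun_pos_of_support_le_gap (γ L Y₁ Y₂ mp : ℝ) (hγ : 0 < γ) (hγ1 : γ ≠ 1)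
    (hL : 0 < L) (hY : Y₁ > Y₂) (hY2 : Y₂ ≥ 0) (hgap : L ≤ Y₁ - Y₂) (hmp : mp > 1) :
    (∀ z : ℝ, 0 < z → 0 < Ffun γ L Y₁ Y₂ mp z) ∧
    ¬ ∃ zbar : ℝ, 0 < zbar ∧ Ffun γ L Y₁ Y₂ mp zbar = 0 := by
  have h := aux_pos γ L Y₁ Y₂ mp hγ hγ1 hL hgap hmp
  exact ⟨h, fun ⟨w, hw, h0⟩ => (h w hw).ne' h0⟩
end
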